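/- arXiv:2602.15403 — 7 statements merged into one kernel-verified Lean document; each statement's English description precedes it below -/
import Mathlib

section
/- For every n ≥ 1, every KD45 model M for n agents, every state s of M, and every formula φ of the language L_C, the axiom Cc holds: M, s ⊨ C(Cφ → φ). -/
/-- Formulas of the language `L_C`: atoms, negation, conjunction, common belief `C`. -/
inductive Formula : Type where
  | atom : ℕ → Formula
  | neg  : Formula → Formula
  | and  : Formula → Formula → Formula
  | box  : Formula → Formula

namespace Formula

/-- Implication `φ → ψ` as a derived connective. -/
def imp (φ ψ : Formula) : Formula := neg (and φ (neg ψ))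

/-- Disjunction `φ ∨ ψ` as a derived connective. -/
def or (φ ψ : Formula) : Formula := neg (and (neg φ) (neg ψ))

/-- The diamond `Ĉφ = ¬C¬φ`. -/
def dia (φ : Formula) : Formula := neg (box (neg φ))

/-- A fixed contradiction (used as the empty disjunction). -/
def bot : Formula := and (atom 0) (neg (atom 0))

/-- A fixed tautology (used as the empty conjunction). -/
def top : Formula := neg bot

end Formula

/-- Finite disjunction of a list of formulas. -/
def bigOr (l : List Formula) : Formula := l.foldr Formula.or Formula.bot

/-- Finite conjunction of a list of formulas. -/
def bigAnd (l : List Formula) : Formula := l.foldr Formula.and Formula.top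

/-- The list of pairs `(i, j)` with `i < j` in `Fin m`. -/
def pairs (m : ℕ) : List (Fin m × Fin m) :=
  ((List.finRange m).product (List.finRange m)).filter (fun p => decide (p.1 < p.2))

/-- A Kripke model for `n` agents. -/
structure Model (n : ℕ) where
  W : Type
  nonempty : Nonempty W
  R : Fin n → W → W → Prop
  V : ℕ → W → Prop

/-- `R*`: the transitive closure of the union of the agents' relations. -/
def Model.star {n : ℕ} (M : Model n) : M.W → M.W → Prop :=
  Relation.TransGen (fun x y => ∃ i, M.R i x y)

/-- Satisfaction: `C` quantifies over `R*`-successors. -/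
def Sat {n : ℕ} (M : Model n) : M.W → Formula → Prop
  | s, .atom p => M.V p s
  | s, .neg φ => ¬ Sat M s φ
  | s, .and φ ψ => Sat M s φ ∧ Sat M s ψ
  | s, .box φ => ∀ t, M.star s t → Sat M t φ

/-- A relation is serial if every point has a successor. -/
def Serial {W : Type} (R : W → W → Prop) : Prop := ∀ x, ∃ y, R x y

/-- A relation is Euclidean if `R x y` and `R x z` imply `R y z`. -/
def Euclidean {W : Type} (R : W → W → Prop) : Prop := ∀ x y z, R x y → R x z → R y z

/-- A KD45 model: all agents' relations are serial, transitive and Euclidean. -/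
def KD45 {n : ℕ} (M : Model n) : Prop :=
  ∀ i, Serial (M.R i) ∧ Transitive (M.R i) ∧ Euclidean (M.R i)

/-- `φ` is an instance of a propositional tautology: it is true under every
assignment of truth values to formulas that respects negation and conjunction. -/
def Tautology (φ : Formula) : Prop :=
  ∀ v : Formula → Prop,
    (∀ ψ, v ψ.neg ↔ ¬ v ψ) →
    (∀ ψ χ, v (ψ.and χ) ↔ (v ψ ∧ v χ)) →
    v φ

/-- The axiom `Cn`: `(C ⋀_{i<j}(Cφᵢ ∨ Cφⱼ)) → ⋁_i Cφᵢ`, for `n+1` formulas. -/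
def CnAx (n : ℕ) (φ : Fin (n + 1) → Formula) : Formula :=
  ((bigAnd ((pairs (n + 1)).map (fun p => Formula.or ((φ p.1).box) ((φ p.2).box)))).box).imp
    (bigOr ((List.finRange (n + 1)).map (fun i => (φ i).box)))

/-- The axiom `Ĉn`: `(⋀_i Ĉφᵢ) → Ĉ(⋁_{i<j}(Ĉφᵢ ∧ Ĉφⱼ))`, for `n+1` formulas. -/
def CHatNAx (n : ℕ) (φ : Fin (n + 1) → Formula) : Formula :=
  (bigAnd ((List.finRange (n + 1)).map (fun i => (φ i).dia))).imp
    ((bigOr ((pairs (n + 1)).map (fun p => ((φ p.1).dia).and ((φ p.2).dia)))).dia)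

/-- In a KD45 model every `R*`-successor is `R*`-related to itself. -/
theorem KD45.star_refl_of_star {n : ℕ} {M : Model n} (hM : KD45 M) {s t : M.W}
    (h : M.star s t) : M.star t t := by
  obtain ⟨u, i, hut⟩ : ∃ u i, M.R i u t := by
    cases h with
    | single h => exact ⟨s, h⟩
    | tail _ h => exact ⟨_, h⟩
  exact .single ⟨i, (hM i).2.2 u t t hut hut⟩

/-- Axiom `Cc`, `C(Cφ → φ)`, is valid on every KD45 model for `n ≥ 1` agents. -/
theorem axiom_Cc_valid :
    ∀ n : ℕ, 1 ≤ n → ∀ M : Model n, KD45 M → ∀ s : M.W, ∀ φ : Formula,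
      Sat M s (((φ.box).imp φ).box) := by
  intro n _ M hM s φ
  simp only [Formula.imp, Sat]
  rintro t hst ⟨hbox, hneg⟩
  exact hneg (hbox t (hM.star_refl_of_star hst))
end

section
/- For every n ≥ 1, every KD45 model M for n agents, every state s of M, and all formulas φ_1, …, φ_{n+1} of L_C, the axiom Ĉn holds at s: if M,s ⊨ Ĉφ_i for every 1 ≤ i ≤ n+1, then M,s ⊨ Ĉ(⋁_{1≤i<j≤n+1}(Ĉφ_i ∧ Ĉφ_j)). -/
theorem sat_dia {n : ℕ} (M : Model n) (s : M.W) (φ : Formula) :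
    Sat M s φ.dia ↔ ∃ t, M.star s t ∧ Sat M t φ := by
  simp [Formula.dia, Sat]

theorem sat_bigOr_of_mem {n : ℕ} (M : Model n) (s : M.W) {l : List Formula} {φ : Formula}
    (hφ : φ ∈ l) (hs : Sat M s φ) : Sat M s (bigOr l) := by
  induction l with
  | nil => simp at hφ
  | cons ψ l ih =>
    change ¬ (¬ Sat M s ψ ∧ ¬ Sat M s (bigOr l))
    rcases List.mem_cons.mp hφ with rfl | h
    · exact fun h => h.1 hs
    · exact fun h' => h'.2 (ih h)

theorem mem_pairs {m : ℕ} {p : Fin m × Fin m} : p ∈ pairs m ↔ p.1 < p.2 := by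
  simp [pairs, List.product]

/-- In a model with Euclidean relations, a successor of `s` for agent `a` reaches everything that
`s` reaches by a path whose first step belongs to `a`. -/
theorem star_of_euclidean {n : ℕ} {M : Model n} {a : Fin n} (ha : Euclidean (M.R a))
    {s x y t : M.W} (hx : M.R a s x) (hy : M.R a s y)
    (hyt : Relation.ReflTransGen (fun x y => ∃ i, M.R i x y) y t) : M.star x t :=
  Relation.TransGen.head' ⟨a, ha s x y hx hy⟩ hyt

/-- Axiom `Ĉn` is valid on every KD45 model for `n ≥ 1` agents: if `Ĉφᵢ` holds at `s`
for all `n+1` formulas, then `Ĉ(⋁_{i<j}(Ĉφᵢ ∧ Ĉφⱼ))` holds at `s`. -/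
theorem axiom_CHatN_valid :
    ∀ n : ℕ, 1 ≤ n → ∀ M : Model n, KD45 M → ∀ s : M.W,
      ∀ φ : Fin (n + 1) → Formula,
        (∀ i, Sat M s ((φ i).dia)) →
        Sat M s ((bigOr ((pairs (n + 1)).map
          (fun p => ((φ p.1).dia).and ((φ p.2).dia)))).dia) := by
  intro n _ M hM s φ h
  have first_step : ∀ i, ∃ a y t, M.R a s y ∧
      Relation.ReflTransGen (fun x y => ∃ i, M.R i x y) y t ∧ Sat M t (φ i) := by
    intro i
    obtain ⟨t, hst, ht⟩ := (sat_dia M s _).mp (h i)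
    obtain ⟨y, ⟨a, hsy⟩, hyt⟩ := Relation.TransGen.head'_iff.mp hst
    exact ⟨a, y, t, hsy, hyt, ht⟩
  choose a y t hsy hyt ht using first_step
  obtain ⟨i, j, hij, haij⟩ : ∃ i j, i < j ∧ a i = a j := by
    obtain ⟨i, j, hne, haij⟩ := Fintype.exists_ne_map_eq_of_card_lt a (by simp)
    rcases lt_or_gt_of_ne hne with hlt | hlt
    · exact ⟨i, j, hlt, haij⟩
    · exact ⟨j, i, hlt, haij.symm⟩
  have hE := (hM (a i)).2.2
  refine (sat_dia M s _).mpr ⟨y i, .single ⟨a i, hsy i⟩, ?_⟩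
  refine sat_bigOr_of_mem M (y i) (List.mem_map.mpr ⟨(i, j), mem_pairs.mpr hij, rfl⟩) ⟨?_, ?_⟩
  · exact (sat_dia M _ _).mpr ⟨t i, star_of_euclidean hE (hsy i) (hsy i) (hyt i), ht i⟩
  · exact (sat_dia M _ _).mpr ⟨t j, star_of_euclidean hE (hsy i) (haij ▸ hsy j) (hyt j), ht j⟩
end

section
/- The axiom system CB_2 is complete with respect to the class of all KD45_2 models: every formula of L_C that is satisfied at every state of every KD45 model for 2 agents is derivable in CB_2. Equivalently, every CB_2-consistent formula is satisfiable in some KD45_2 model. -/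
/-- The Hilbert system `CB_n`: Prop, K, D, 4, Cc, Cn, with modus ponens and necessitation. -/
inductive CB (n : ℕ) : Formula → Prop
  | taut {φ : Formula} : Tautology φ → CB n φ
  | K (φ ψ : Formula) : CB n (((φ.imp ψ).box).imp ((φ.box).imp (ψ.box)))
  | D (φ : Formula) : CB n ((φ.box).imp (((φ.neg).box).neg))
  | four (φ : Formula) : CB n ((φ.box).imp ((φ.box).box))
  | Cc (φ : Formula) : CB n (((φ.box).imp φ).box)
  | Cn (φ : Fin (n + 1) → Formula) : CB n (CnAx n φ)
  | mp {φ ψ : Formula} : CB n (φ.imp ψ) → CB n φ → CB n ψ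
  | nec {φ : Formula} : CB n φ → CB n (φ.box)

/-- A truth assignment respecting negation and conjunction. -/
def Respects (v : Formula → Prop) : Prop :=
  (∀ ψ, v ψ.neg ↔ ¬ v ψ) ∧ ∀ ψ χ, v (ψ.and χ) ↔ (v ψ ∧ v χ)

namespace Respects

variable {v : Formula → Prop}

theorem imp (h : Respects v) (φ ψ : Formula) : v (φ.imp ψ) ↔ (v φ → v ψ) := by
  simp [Formula.imp, h.1, h.2]

theorem or (h : Respects v) (φ ψ : Formula) : v (φ.or ψ) ↔ (v φ ∨ v ψ) := by
  simp only [Formula.or, h.1, h.2]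
  tauto

theorem not_bot (h : Respects v) : ¬ v Formula.bot := by
  simp [Formula.bot, h.1, h.2]

theorem bigOr (h : Respects v) (l : List Formula) : v (bigOr l) ↔ ∃ φ ∈ l, v φ := by
  induction l with
  | nil => simpa [_root_.bigOr] using h.not_bot
  | cons a l ih =>
    have : v (_root_.bigOr (a :: l)) ↔ v a ∨ v (_root_.bigOr l) := h.or _ _
    simp [this, ih]

theorem bigAnd (h : Respects v) (l : List Formula) : v (bigAnd l) ↔ ∀ φ ∈ l, v φ := by
  induction l with
  | nil => simpa [_root_.bigAnd, Formula.top, h.1] using h.not_bot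
  | cons a l ih =>
    have : v (_root_.bigAnd (a :: l)) ↔ v a ∧ v (_root_.bigAnd l) := h.2 _ _
    simp [this, ih]

end Respects

theorem tautology_of_respects {φ : Formula} (h : ∀ v, Respects v → v φ) : Tautology φ :=
  fun v hn ha => h v ⟨hn, ha⟩

/-- A set of formulas containing the theorems of `CB n` and closed under modus ponens. -/
def IsTheory (n : ℕ) (T : Set Formula) : Prop :=
  (∀ φ, CB n φ → φ ∈ T) ∧ ∀ φ ψ, φ.imp ψ ∈ T → φ ∈ T → ψ ∈ T

namespace IsTheory

variable {n : ℕ} {T : Set Formula}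

theorem mem_of_valid (hT : IsTheory n T) {φ : Formula} (h : ∀ v, Respects v → v φ) : φ ∈ T :=
  hT.1 _ (.taut (tautology_of_respects h))

theorem mem_of_valid_imp (hT : IsTheory n T) {φ ψ : Formula} (hφ : φ ∈ T)
    (h : ∀ v, Respects v → v φ → v ψ) : ψ ∈ T :=
  hT.2 φ ψ (hT.mem_of_valid fun v hv => (hv.imp _ _).2 (h v hv)) hφ

theorem mem_of_valid_imp₂ (hT : IsTheory n T) {φ ψ χ : Formula} (hφ : φ ∈ T) (hψ : ψ ∈ T)
    (h : ∀ v, Respects v → v φ → v ψ → v χ) : χ ∈ T :=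
  hT.2 ψ χ (hT.mem_of_valid_imp hφ fun v hv h₁ => (hv.imp _ _).2 (h v hv h₁)) hψ

/-- Adjoining a hypothesis to a theory. -/
theorem adjoin (hT : IsTheory n T) (α : Formula) : IsTheory n {β | α.imp β ∈ T} := by
  refine ⟨fun φ hφ => hT.mem_of_valid_imp (hT.1 φ hφ) ?_, fun φ ψ h₁ h₂ =>
    hT.mem_of_valid_imp₂ h₁ h₂ ?_⟩
  · intro v hv h
    exact (hv.imp _ _).2 fun _ => h
  · intro v hv
    simp only [hv.imp]
    tauto

end IsTheory

/-- A world of the canonical model: a truth assignment satisfying all theorems. -/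
structure World (n : ℕ) where
  val : Formula → Prop
  respects : Respects val
  thm : ∀ φ, CB n φ → val φ

/-- Lindenbaum's lemma for theories. -/
theorem IsTheory.exists_world {n : ℕ} {T : Set Formula} (hT : IsTheory n T) {ψ : Formula}
    (hψ : ψ ∉ T) : ∃ w : World n, (∀ φ ∈ T, w.val φ) ∧ ¬ w.val ψ := by
  obtain ⟨M, hTM, ⟨hM, hψM⟩, hmax⟩ := zorn_subset_nonempty {S | IsTheory n S ∧ ψ ∉ S} (by
    intro c hc hchain ⟨S₀, hS₀⟩
    refine ⟨⋃₀ c, ⟨⟨fun φ hφ => ⟨S₀, hS₀, (hc hS₀).1.1 φ hφ⟩, ?_⟩, ?_⟩,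
      fun s hs => Set.subset_sUnion_of_mem hs⟩
    · rintro φ χ ⟨A, hA, h₁⟩ ⟨B, hB, h₂⟩
      rcases hchain.total hA hB with h | h
      · exact ⟨B, hB, (hc hB).1.2 _ _ (h h₁) h₂⟩
      · exact ⟨A, hA, (hc hA).1.2 _ _ h₁ (h h₂)⟩
    · rintro ⟨A, hA, h⟩
      exact (hc hA).2 h) T ⟨hT, hψ⟩
  have key : ∀ α, α ∉ M → α.imp ψ ∈ M := by
    intro α hα
    by_contra hcon
    refine hα (hmax (y := {β | α.imp β ∈ M}) ⟨hM.adjoin α, hcon⟩ ?_ ?_)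
    · exact fun β hβ => hM.mem_of_valid_imp hβ fun v hv h => (hv.imp _ _).2 fun _ => h
    · exact hM.mem_of_valid fun v hv => (hv.imp _ _).2 id
  refine ⟨⟨(· ∈ M), ⟨fun α => ⟨fun h₁ h₂ => ?_, fun h => ?_⟩, fun α β => ⟨fun h => ?_, ?_⟩⟩,
    hM.1⟩, fun φ hφ => hTM hφ, hψM⟩
  · exact hψM (hM.mem_of_valid_imp₂ h₁ h₂ fun v hv a b => absurd b ((hv.1 _).1 a))
  · by_contra hn
    refine hψM (hM.mem_of_valid_imp₂ (key _ h) (key _ hn) fun v hv => ?_)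
    simp only [hv.imp, hv.1]
    tauto
  · exact ⟨hM.mem_of_valid_imp h fun v hv a => ((hv.2 _ _).1 a).1,
      hM.mem_of_valid_imp h fun v hv a => ((hv.2 _ _).1 a).2⟩
  · rintro ⟨h₁, h₂⟩
    exact hM.mem_of_valid_imp₂ h₁ h₂ fun v hv a b => (hv.2 _ _).2 ⟨a, b⟩

namespace World

variable {n : ℕ}

/-- The accessibility relation of the canonical model. -/
def Rel (s t : World n) : Prop := ∀ φ, s.val φ.box → t.val φ

theorem mp (s : World n) {φ ψ : Formula} (h : CB n (φ.imp ψ)) (hφ : s.val φ) : s.val ψ :=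
  (s.respects.imp _ _).1 (s.thm _ h) hφ

theorem exists_rel_of_not_box {s : World n} {ψ : Formula} (h : ¬ s.val ψ.box) :
    ∃ t, s.Rel t ∧ ¬ t.val ψ :=
  IsTheory.exists_world (T := {φ | s.val φ.box})
    ⟨fun _ hφ => s.thm _ (.nec hφ),
      fun φ χ h₁ h₂ => (s.respects.imp _ _).1 (s.mp (.K φ χ) h₁) h₂⟩ h

theorem Rel.box {s t : World n} (h : s.Rel t) {φ : Formula} (hφ : s.val φ.box) : t.val φ.box :=
  h _ (s.mp (.four φ) hφ)

theorem Rel.trans {s t u : World n} (h₁ : s.Rel t) (h₂ : t.Rel u) : s.Rel u :=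
  fun _ hφ => h₂ _ (h₁.box hφ)

theorem Rel.refl_right {s t : World n} (h : s.Rel t) : t.Rel t :=
  fun _ => (t.respects.imp _ _).1 (h _ (s.thm _ (.Cc _)))

theorem exists_rel (s : World n) : ∃ t, s.Rel t := by
  have h : ¬ s.val Formula.bot.box := fun hb =>
    (s.respects.1 _).1 (s.mp (.D _) hb) (s.thm _ (.nec (.taut (tautology_of_respects
      fun v hv => (hv.1 _).2 hv.not_bot))))
  obtain ⟨t, ht, -⟩ := exists_rel_of_not_box h
  exact ⟨t, ht⟩

theorem exists_rel_two_of_not_box {s : World n} (χ : Fin (n + 1) → Formula)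
    (h : ∀ i, ¬ s.val (χ i).box) :
    ∃ t, s.Rel t ∧ ∃ i j, i < j ∧ ¬ t.val (χ i).box ∧ ¬ t.val (χ j).box := by
  have hnot : ¬ s.val ((bigAnd ((pairs (n + 1)).map
      (fun p => Formula.or ((χ p.1).box) ((χ p.2).box)))).box) := by
    intro hb
    have := s.mp (.Cn χ) hb
    rw [s.respects.bigOr] at this
    obtain ⟨φ, hφ, hv⟩ := this
    obtain ⟨i, -, rfl⟩ := List.mem_map.1 hφ
    exact h i hv
  obtain ⟨t, hst, ht⟩ := exists_rel_of_not_box hnot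
  refine ⟨t, hst, ?_⟩
  rw [t.respects.bigAnd] at ht
  push Not at ht
  obtain ⟨φ, hφ, hv⟩ := ht
  obtain ⟨p, hp, rfl⟩ := List.mem_map.1 hφ
  rw [t.respects.or, not_or] at hv
  exact ⟨p.1, p.2, by simpa using (List.mem_filter.1 hp).2, hv⟩

/-- Some successor of `s` falsifies `Cψ` for every `ψ ∈ S`. -/
def Refutes (s : World n) (S : Set Formula) : Prop :=
  ∃ t, s.Rel t ∧ ∀ ψ ∈ S, ¬ t.val ψ.box

theorem refutes_singleton {s : World n} {ψ : Formula} (h : ¬ s.val ψ.box) : s.Refutes {ψ} := by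
  obtain ⟨t, hst, ht⟩ := exists_rel_of_not_box h
  exact ⟨t, hst, by rintro _ rfl hb; exact ht (hst.refl_right _ hb)⟩

theorem exists_refutes_union {s : World n} (S : Fin (n + 1) → Set Formula)
    (hfin : ∀ i, (S i).Finite) (h : ∀ i, s.Refutes (S i)) :
    ∃ i j, i < j ∧ s.Refutes (S i ∪ S j) := by
  let χ : Fin (n + 1) → Formula := fun i => bigOr ((hfin i).toFinset.toList.map Formula.box)
  have hχ : ∀ i (t : World n), t.val (χ i) ↔ ∃ ψ ∈ S i, t.val ψ.box := by
    intro i t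
    simp [χ, t.respects.bigOr]
  have key : ∀ i (t : World n), ¬ t.val (χ i).box → ∀ ψ ∈ S i, ¬ t.val ψ.box := by
    intro i t ht ψ hψ hb
    obtain ⟨u, htu, hu⟩ := exists_rel_of_not_box ht
    exact hu ((hχ i u).2 ⟨ψ, hψ, htu.box hb⟩)
  obtain ⟨t, hst, i, j, hij, hi, hj⟩ := exists_rel_two_of_not_box (s := s) χ (by
    intro i hb
    obtain ⟨r, hr, hS⟩ := h i
    obtain ⟨ψ, hψ, hv⟩ := (hχ i r).1 (hr _ hb)
    exact hS ψ hψ hv)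
  exact ⟨i, j, hij, t, hst, fun ψ hψ => hψ.elim (key i t hi ψ) (key j t hj ψ)⟩

/-- For finitely many formulas, two successors refute all the boxes refuted at a world. -/
theorem exists_two_refuting (s : World 2) {F : Set Formula} (hF : F.Finite) :
    ∃ r : Fin 2 → World 2, (∀ i, s.Rel (r i)) ∧
      ∀ ψ ∈ F, ¬ s.val ψ.box → ∃ i, ¬ (r i).val ψ.box := by
  set G : Set Formula := {ψ ∈ F | ¬ s.val ψ.box} with hG
  have hGfin : G.Finite := hF.subset fun _ h => h.1
  have hfam : {S | S ⊆ G ∧ s.Refutes S}.Finite :=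
    hGfin.finite_subsets.subset fun _ h => h.1
  have hmax : ∀ S ⊆ G, s.Refutes S →
      ∃ S', S ⊆ S' ∧ Maximal (· ∈ {S | S ⊆ G ∧ s.Refutes S}) S' :=
    fun S h₁ h₂ => hfam.exists_le_maximal ⟨h₁, h₂⟩
  suffices h : ∃ A B, s.Refutes A ∧ s.Refutes B ∧ G ⊆ A ∪ B by
    obtain ⟨A, B, ⟨a, hsa, ha⟩, ⟨b, hsb, hb⟩, hAB⟩ := h
    refine ⟨![a, b], ?_, fun ψ hψ hs => ?_⟩
    · simp [Fin.forall_fin_two, hsa, hsb]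
    · rw [Fin.exists_fin_two]
      exact (hAB ⟨hψ, hs⟩).imp (ha ψ) (hb ψ)
  by_contra! hcon
  obtain ⟨t, ht⟩ := s.exists_rel
  obtain ⟨A, -, hA⟩ := hmax ∅ (Set.empty_subset _) ⟨t, ht, by simp⟩
  obtain ⟨b, hbG, hbA⟩ := Set.not_subset.1 (hcon A A hA.1.2 hA.1.2)
  obtain ⟨B, hbB, hB⟩ := hmax {b} (by simpa using hbG) (refutes_singleton hbG.2)
  obtain ⟨c, hcG, hcAB⟩ := Set.not_subset.1 (hcon A B hA.1.2 hB.1.2)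
  obtain ⟨D, hcD, hD⟩ := hmax {c} (by simpa using hcG) (refutes_singleton hcG.2)
  have absorb : ∀ {X Y : Set Formula}, Maximal (· ∈ {S | S ⊆ G ∧ s.Refutes S}) X →
      Y ⊆ G → s.Refutes (X ∪ Y) → Y ⊆ X := fun hX hY h =>
    Set.subset_union_right.trans
      (hX.2 ⟨Set.union_subset hX.1.1 hY, h⟩ Set.subset_union_left)
  simp only [Set.singleton_subset_iff] at hbB hcD
  have hAB : ¬ s.Refutes (A ∪ B) := fun h => hbA (Or.inl (absorb hA hB.1.1 h hbB))
  have hAD : ¬ s.Refutes (A ∪ D) := fun h => hcAB (Or.inl (absorb hA hD.1.1 h hcD))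
  have hBD : ¬ s.Refutes (B ∪ D) := fun h => hcAB (Or.inr (absorb hB hD.1.1 h hcD))
  obtain ⟨i, j, hij, h⟩ := exists_refutes_union (s := s) ![A, B, D]
    (by simp [Fin.forall_fin_succ, hGfin.subset hA.1.1, hGfin.subset hB.1.1,
      hGfin.subset hD.1.1])
    (by simp [Fin.forall_fin_succ, hA.1.2, hB.1.2, hD.1.2])
  obtain ⟨rfl, rfl⟩ | ⟨rfl, rfl⟩ | ⟨rfl, rfl⟩ :
      (i = 0 ∧ j = 1) ∨ (i = 0 ∧ j = 2) ∨ (i = 1 ∧ j = 2) := by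
    clear h
    revert i j
    decide
  exacts [hAB h, hAD h, hBD h]

end World

/-- A point of an agent's cluster: the agent `home`, the canonical world `here` the point is a copy
of, and the world `next` whose cluster the other agent considers possible. -/
structure ClusterPoint where
  home : Fin 2
  here : World 2
  next : World 2
  rel : here.Rel next

/-- The canonical world whose cluster agent `i` considers possible. -/
def target (ρ : Fin 2 → World 2) (i : Fin 2) : Option ClusterPoint → World 2
  | none => ρ i
  | some x => if x.home = i then x.here else x.next

/-- The KD45 model with root `s` whose agents' clusters at the root copy the worlds `ρ i`. -/
def clusterModel (s : World 2) (ρ : Fin 2 → World 2) : Model 2 where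
  W := Option ClusterPoint
  nonempty := ⟨none⟩
  R i x y := ∃ z, y = some z ∧ z.home = i ∧ z.here = target ρ i x
  V p x := (x.elim s ClusterPoint.here).val (.atom p)

section ClusterModel

variable {s : World 2} {ρ : Fin 2 → World 2}

theorem target_refl (hρ : ∀ i, (ρ i).Rel (ρ i)) (i : Fin 2) (x : Option ClusterPoint) :
    (target ρ i x).Rel (target ρ i x) ∨ ∃ y, x = some y ∧ y.home = i := by
  rcases x with _ | x
  · exact Or.inl (hρ i)
  · by_cases h : x.home = i
    · exact Or.inr ⟨x, rfl, h⟩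
    · left
      simpa [target, h] using x.rel.refl_right

theorem clusterModel_KD45 (hρ : ∀ i, (ρ i).Rel (ρ i)) : KD45 (clusterModel s ρ) := by
  refine fun i => ⟨fun x => ?_, ?_, ?_⟩
  · rcases target_refl hρ i x with h | ⟨y, rfl, hy⟩
    · exact ⟨some ⟨i, _, _, h⟩, _, rfl, rfl, rfl⟩
    · exact ⟨some y, y, rfl, hy, by simp [target, hy]⟩
  · rintro x _ _ ⟨y, rfl, hy, hyx⟩ ⟨z, rfl, hz, hzy⟩
    exact ⟨z, rfl, hz, by simpa [target, hy, hyx] using hzy⟩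
  · rintro x _ _ ⟨y, rfl, hy, hyx⟩ ⟨z, rfl, hz, hzx⟩
    exact ⟨z, rfl, hz, by simp [target, hy, hyx, hzx]⟩

theorem rel_here_of_star {x : ClusterPoint} (hx : x.here.Rel x.here)
    {y : (clusterModel s ρ).W} (h : (clusterModel s ρ).star (some x) y) :
    ∃ z, y = some z ∧ x.here.Rel z.here := by
  have step : ∀ {a : ClusterPoint} {b : (clusterModel s ρ).W}, x.here.Rel a.here →
      (∃ i, (clusterModel s ρ).R i (some a) b) → ∃ z, b = some z ∧ x.here.Rel z.here := by
    rintro a _ ha ⟨i, z, rfl, -, hz⟩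
    refine ⟨z, rfl, ?_⟩
    rw [hz]
    by_cases hi : a.home = i
    · simpa [target, hi] using ha
    · simpa [target, hi] using ha.trans a.rel
  induction h with
  | single h => exact step hx h
  | tail _ h ih =>
    obtain ⟨z, rfl, hz⟩ := ih
    exact step hz h

/-- Entering agent `i`'s cluster of copies of `r`, one reaches a copy of every successor of `r`. -/
theorem exists_star_of_rel {i : Fin 2} {x : (clusterModel s ρ).W} {t : World 2}
    (h : (target ρ i x).Rel t) :
    ∃ z : ClusterPoint, (clusterModel s ρ).star x (some z) ∧ z.here = t ∧ t.Rel t := by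
  refine ⟨⟨i + 1, t, t, h.refl_right⟩, .tail (b := some ⟨i, _, t, h⟩)
    (.single ⟨i, _, rfl, rfl, rfl⟩) ⟨i + 1, _, rfl, rfl, ?_⟩, rfl, h.refl_right⟩
  have : i ≠ i + 1 := by omega
  simp [target, this]

theorem sat_clusterPoint (φ : Formula) : ∀ x : ClusterPoint, x.here.Rel x.here →
    (Sat (clusterModel s ρ) (some x) φ ↔ x.here.val φ) := by
  induction φ with
  | atom p => exact fun x _ => Iff.rfl
  | neg φ ih => exact fun x hx => (not_congr (ih x hx)).trans (x.here.respects.1 φ).symm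
  | and φ ψ ihφ ihψ =>
    exact fun x hx => (and_congr (ihφ x hx) (ihψ x hx)).trans (x.here.respects.2 φ ψ).symm
  | box φ ih =>
    refine fun x hx => ⟨fun h => ?_, fun h t ht => ?_⟩
    · by_contra hb
      obtain ⟨t, hxt, ht⟩ := World.exists_rel_of_not_box hb
      obtain ⟨z, hz, rfl, hzz⟩ := exists_star_of_rel (s := s) (ρ := ρ) (i := x.home)
        (x := some x) (t := t) (by simpa [target] using hxt)
      exact ht ((ih z hzz).1 (h _ hz))
    · obtain ⟨z, rfl, hz⟩ := rel_here_of_star hx ht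
      exact (ih z hz.refl_right).2 (hz _ h)

end ClusterModel

/-- The arguments of the outermost boxes of a formula. -/
def Formula.boxArgs : Formula → Set Formula
  | .atom _ => ∅
  | .neg φ => φ.boxArgs
  | .and φ ψ => φ.boxArgs ∪ ψ.boxArgs
  | .box φ => {φ}

theorem Formula.finite_boxArgs (φ : Formula) : φ.boxArgs.Finite := by
  induction φ with
  | atom p => exact Set.finite_empty
  | neg φ ih => exact ih
  | and φ ψ ihφ ihψ => exact ihφ.union ihψ
  | box φ => exact Set.finite_singleton φ

theorem sat_root {s : World 2} {ρ : Fin 2 → World 2} (hρ : ∀ i, s.Rel (ρ i)) (φ : Formula)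
    (hF : ∀ ψ ∈ φ.boxArgs, ¬ s.val ψ.box → ∃ i, ¬ (ρ i).val ψ.box) :
    Sat (clusterModel s ρ) none φ ↔ s.val φ := by
  induction φ with
  | atom p => exact Iff.rfl
  | neg φ ih => exact (not_congr (ih hF)).trans (s.respects.1 φ).symm
  | and φ ψ ihφ ihψ =>
    exact (and_congr (ihφ fun χ h => hF χ (Or.inl h))
      (ihψ fun χ h => hF χ (Or.inr h))).trans (s.respects.2 φ ψ).symm
  | box φ =>
    refine ⟨fun h => ?_, fun h t ht => ?_⟩
    · by_contra hb
      obtain ⟨i, hi⟩ := hF φ rfl hb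
      obtain ⟨t, hit, ht⟩ := World.exists_rel_of_not_box hi
      obtain ⟨z, hz, rfl, hzz⟩ := exists_star_of_rel (s := s) (ρ := ρ) (i := i) (x := none) hit
      exact ht ((sat_clusterPoint φ z hzz).1 (h _ hz))
    · have hz : ∃ z : ClusterPoint, t = some z ∧ s.Rel z.here := by
        obtain ⟨y, ⟨i, z, rfl, -, hz⟩, hyt⟩ := Relation.TransGen.head'_iff.1 ht
        have hsz : s.Rel z.here := by rw [hz]; exact hρ i
        rcases Relation.reflTransGen_iff_eq_or_transGen.1 hyt with rfl | hyt
        · exact ⟨z, rfl, hsz⟩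
        · obtain ⟨u, rfl, hu⟩ := rel_here_of_star hsz.refl_right hyt
          exact ⟨u, rfl, hsz.trans hu⟩
      obtain ⟨z, rfl, hz⟩ := hz
      exact (sat_clusterPoint φ z hz.refl_right).2 (hz _ h)

theorem CB2_of_valid (φ : Formula)
    (h : ∀ M : Model 2, KD45 M → ∀ s : M.W, Sat M s φ) : CB 2 φ := by
  by_contra hφ
  obtain ⟨s, -, hs⟩ := IsTheory.exists_world (T := {φ | CB 2 φ})
    ⟨fun _ h => h, fun _ _ => CB.mp⟩ hφ
  obtain ⟨ρ, hρ, hF⟩ := s.exists_two_refuting φ.finite_boxArgs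
  exact hs ((sat_root hρ φ hF).1
    (h _ (clusterModel_KD45 fun i => (hρ i).refl_right) none))

/-- Completeness of `CB_2` with respect to the class of all KD45 models for 2 agents:
every valid formula is derivable; equivalently, every `CB_2`-consistent formula
is satisfiable in some KD45 model for 2 agents. -/
theorem CB2_complete :
    (∀ φ : Formula, (∀ M : Model 2, KD45 M → ∀ s : M.W, Sat M s φ) → CB 2 φ) ∧
    (∀ φ : Formula, ¬ CB 2 (φ.neg) →
      ∃ M : Model 2, KD45 M ∧ ∃ s : M.W, Sat M s φ) := by
  refine ⟨CB2_of_valid, fun φ hφ => ?_⟩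
  by_contra! hcon
  exact hφ (CB2_of_valid _ hcon)
end

section
/- The axiom Ĉ2 is not valid over three agents: there exist a KD45 model M for 3 agents, a state s of M, and formulas φ_1, φ_2, φ_3 of L_C (atomic propositions suffice) such that M,s ⊨ Ĉφ_1 ∧ Ĉφ_2 ∧ Ĉφ_3 but M,s ⊭ Ĉ((Ĉφ_1 ∧ Ĉφ_2) ∨ (Ĉφ_1 ∧ Ĉφ_3) ∨ (Ĉφ_2 ∧ Ĉφ_3)). -/
theorem sat_or {n : ℕ} (M : Model n) (s : M.W) (φ ψ : Formula) :
    Sat M s (φ.or ψ) ↔ Sat M s φ ∨ Sat M s ψ := by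
  simp only [Formula.or, Sat]
  tauto

/-- The model with a root `none` from which agent `i` sees only the point `some i`; each point
`some i` sees only itself, and is the only point at which the atom `i` holds. -/
def fork (n : ℕ) : Model n where
  W := Option (Fin n)
  nonempty := ⟨none⟩
  R i x y := y = some (x.getD i)
  V p x := ∃ j, x = some j ∧ j.val = p

theorem fork_kd45 (n : ℕ) : KD45 (fork n) := by
  refine fun i => ⟨fun x => ⟨_, rfl⟩, ?_, ?_⟩
  · rintro x y z rfl rfl
    rfl
  · rintro x y z rfl rfl
    rfl

theorem fork_star_some {n : ℕ} {j : Fin n} {t : (fork n).W} (h : (fork n).star (some j) t) :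
    t = some j := by
  induction h with
  | single h =>
    obtain ⟨i, rfl⟩ := h
    rfl
  | tail _ h ih =>
    subst ih
    obtain ⟨i, rfl⟩ := h
    rfl

theorem fork_star_exists_some {n : ℕ} {s t : (fork n).W} (h : (fork n).star s t) :
    ∃ j, t = some j := by
  cases h with
  | single h => exact h.elim fun _ h => ⟨_, h⟩
  | tail _ h => exact h.elim fun _ h => ⟨_, h⟩

theorem sat_fork_none_dia_atom {n : ℕ} (i : Fin n) :
    Sat (fork n) none (Formula.atom i).dia :=
  (sat_dia _ _ _).2 ⟨some i, .single ⟨i, rfl⟩, i, rfl, rfl⟩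

theorem eq_of_sat_fork_some_dia_atom {n p : ℕ} {j : Fin n}
    (h : Sat (fork n) (some j) (Formula.atom p).dia) : j.val = p := by
  obtain ⟨t, ht, k, rfl, hk⟩ := (sat_dia _ _ _).1 h
  exact Option.some.inj (fork_star_some ht) ▸ hk

/-- `Ĉ2` is not valid over three agents: some KD45 model for 3 agents, state, and
formulas satisfy the antecedent of `Ĉ2` but not its conclusion. -/
theorem CHat2_not_valid_three_agents :
    ∃ M : Model 3, KD45 M ∧ ∃ s : M.W, ∃ φ₁ φ₂ φ₃ : Formula,
      Sat M s ((φ₁.dia).and ((φ₂.dia).and (φ₃.dia))) ∧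
      ¬ Sat M s ((Formula.or ((φ₁.dia).and (φ₂.dia))
          (Formula.or ((φ₁.dia).and (φ₃.dia)) ((φ₂.dia).and (φ₃.dia)))).dia) := by
  refine ⟨fork 3, fork_kd45 3, none, .atom 0, .atom 1, .atom 2,
    ⟨sat_fork_none_dia_atom 0, sat_fork_none_dia_atom 1, sat_fork_none_dia_atom 2⟩, fun h => ?_⟩
  obtain ⟨t, ht, h⟩ := (sat_dia _ _ _).1 h
  rw [sat_or, sat_or] at h
  obtain ⟨j, rfl⟩ := fork_star_exists_some ht
  obtain ⟨h, h'⟩ | ⟨h, h'⟩ | ⟨h, h'⟩ := h <;>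
  · have := eq_of_sat_fork_some_dia_atom h
    have := eq_of_sat_fork_some_dia_atom h'
    omega
end

section
/- Let R_1, …, R_n (n ≥ 1) be Euclidean binary relations on a set W and let R* be the transitive closure of ⋃_{i=1..n} R_i. For all states s, t_1, …, t_{n+1}, if R* s t_i for every 1 ≤ i ≤ n+1, then there exists a state z with R* s z and, for some 1 ≤ i < j ≤ n+1, both R* z t_i and R* z t_j. -/
/-- If `r` is Euclidean, `a` has `r`-successors `b` and `c`, and `d` is reachable from `c`
along steps containing `r`, then `d` is reachable from `b` in at least one step. -/
theorem Euclidean.transGen_of_sibling {W : Type} {r q : W → W → Prop} (hr : Euclidean r)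
    (hrq : ∀ x y, r x y → q x y) {a b c d : W} (hab : r a b) (hac : r a c)
    (hcd : Relation.ReflTransGen q c d) : Relation.TransGen q b d :=
  Relation.TransGen.head' (hrq b c (hr a b c hab hac)) hcd

/-- The relational fact underlying soundness of `Cn`: if the `Rᵢ` (`1 ≤ i ≤ n`,
`n ≥ 1`) are Euclidean and `R* s tᵢ` for `n+1` states `tᵢ`, then some `z` with
`R* s z` reaches two of them. -/
theorem transClosure_CnProperty {W : Type} (n : ℕ) (hn : 1 ≤ n)
    (R : Fin n → W → W → Prop) (h : ∀ i, Euclidean (R i)) :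
    ∀ (s : W) (t : Fin (n + 1) → W),
      (∀ i, Relation.TransGen (fun x y => ∃ i, R i x y) s (t i)) →
      ∃ z : W, Relation.TransGen (fun x y => ∃ i, R i x y) s z ∧
        ∃ i j : Fin (n + 1), i < j ∧
          Relation.TransGen (fun x y => ∃ i, R i x y) z (t i) ∧
          Relation.TransGen (fun x y => ∃ i, R i x y) z (t j) := by
  intro s t ht
  choose u hu hut using fun i => Relation.TransGen.head'_iff.mp (ht i)
  choose a ha using hu
  obtain ⟨i, j, hij, haij⟩ : ∃ i j, i < j ∧ a i = a j := by
    obtain ⟨i, j, hne, heq⟩ := Fintype.exists_ne_map_eq_of_card_lt a (by simp)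
    rcases hne.lt_or_gt with hlt | hlt
    · exact ⟨i, j, hlt, heq⟩
    · exact ⟨j, i, hlt, heq.symm⟩
  have hsub : ∀ x y, R (a i) x y → ∃ k, R k x y := fun _ _ hxy => ⟨a i, hxy⟩
  exact ⟨u i, .single ⟨a i, ha i⟩, i, j, hij,
    (h (a i)).transGen_of_sibling hsub (ha i) (ha i) (hut i),
    (h (a i)).transGen_of_sibling hsub (ha i) (haij ▸ ha j) (hut j)⟩
end

section
/- Bisimulation invariance for L_C: let M^1 = (S^1, (R^1_i)_{i=1..n}, V^1) and M^2 = (S^2, (R^2_i)_{i=1..n}, V^2) be Kripke models for n agents, and let Z ⊆ S^1 × S^2 be a bisimulation (satisfying Atoms, Forth and Back for every agent i). Then for all s, t with s Z t and every formula φ of L_C interpreted via the transitive closures R^{1*} and R^{2*}: M^1,s ⊨ φ if and only if M^2,t ⊨ φ. -/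
/-- If `Z` is a simulation of `r` by `r'`, it is also a simulation of their transitive closures. -/
theorem Relation.TransGen.exists_of_simulation {α β : Type*} {r : α → α → Prop}
    {r' : β → β → Prop} {Z : α → β → Prop}
    (hZ : ∀ a b, Z a b → ∀ a', r a a' → ∃ b', r' b b' ∧ Z a' b')
    {a a' : α} {b : β} (hab : Z a b) (h : Relation.TransGen r a a') :
    ∃ b', Relation.TransGen r' b b' ∧ Z a' b' := by
  induction h with
  | single h =>
    obtain ⟨b', hb, hz⟩ := hZ _ _ hab _ h
    exact ⟨b', .single hb, hz⟩
  | tail _ h ih =>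
    obtain ⟨c, hc, hz⟩ := ih
    obtain ⟨b', hb, hz'⟩ := hZ _ _ hz _ h
    exact ⟨b', .tail hc hb, hz'⟩

/-- Bisimulation invariance for `L_C`: bisimilar states satisfy the same formulas
(interpreted via the transitive closures of the unions of the agents' relations). -/
theorem bisimulation_invariance (n : ℕ) (M₁ M₂ : Model n)
    (Z : M₁.W → M₂.W → Prop)
    (hne : ∃ s t, Z s t)
    (atoms : ∀ s t, Z s t → ∀ p, M₁.V p s ↔ M₂.V p t)
    (forth : ∀ s t, Z s t → ∀ i u, M₁.R i s u → ∃ v, M₂.R i t v ∧ Z u v)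
    (back : ∀ s t, Z s t → ∀ i v, M₂.R i t v → ∃ u, M₁.R i s u ∧ Z u v) :
    ∀ s t, Z s t → ∀ φ : Formula, Sat M₁ s φ ↔ Sat M₂ t φ := by
  have forth_star : ∀ s t, Z s t → ∀ u, M₁.star s u → ∃ v, M₂.star t v ∧ Z u v := by
    refine fun s t hst u hu => Relation.TransGen.exists_of_simulation ?_ hst hu
    rintro a b hab a' ⟨i, hi⟩
    obtain ⟨b', hb, hz⟩ := forth a b hab i a' hi
    exact ⟨b', ⟨i, hb⟩, hz⟩
  have back_star : ∀ s t, Z s t → ∀ v, M₂.star t v → ∃ u, M₁.star s u ∧ Z u v := by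
    refine fun s t hst v hv =>
      Relation.TransGen.exists_of_simulation (Z := fun b a => Z a b) ?_ hst hv
    rintro b a hab b' ⟨i, hi⟩
    obtain ⟨a', ha, hz⟩ := back a b hab i b' hi
    exact ⟨a', ⟨i, ha⟩, hz⟩
  intro s t hst φ
  induction φ generalizing s t with
  | atom p => exact atoms s t hst p
  | neg φ ih => exact not_congr (ih s t hst)
  | and φ ψ ihφ ihψ => exact and_congr (ihφ s t hst) (ihψ s t hst)
  | box φ ih =>
    constructor
    · intro h v hv
      obtain ⟨u, hu, hz⟩ := back_star s t hst v hv
      exact (ih u v hz).1 (h u hu)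
    · intro h u hu
      obtain ⟨v, hv, hz⟩ := forth_star s t hst u hu
      exact (ih u v hz).2 (h v hv)
end

section
/- Common belief over KD45 does not satisfy negative introspection: there exist a KD45 model M for 2 agents, a state s of M, and an atomic proposition p such that M,s ⊨ ¬Cp but M,s ⊭ C¬Cp; that is, the 5 axiom ¬Cφ → C¬Cφ for the common belief operator fails on the class of KD45_2 models. -/
/-- The three-state witnessing model: from the root `none`, agent `i` sees only `some i`, and at
`some j` both agents see only `some j`; every atom is true exactly at `some 0`. -/
def forkModel : Model 2 where
  W := Option (Fin 2)
  nonempty := ⟨none⟩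
  R i x y := y = some (x.getD i)
  V _ x := x = some 0

theorem forkModel_kd45 : KD45 forkModel := by
  refine fun i => ⟨fun x => ⟨_, rfl⟩, ?_, ?_⟩
  · rintro x y z rfl rfl
    rfl
  · rintro x y z rfl rfl
    rfl

theorem forkModel_star_none (i : Fin 2) : forkModel.star none (some i) :=
  Relation.TransGen.single ⟨i, rfl⟩

theorem eq_of_forkModel_star_some {j : Fin 2} {y : forkModel.W}
    (h : forkModel.star (some j) y) : y = some j := by
  induction h with
  | single h =>
    obtain ⟨_, rfl⟩ := h
    rfl
  | tail _ h ih =>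
    obtain ⟨_, rfl⟩ := h
    rw [ih]
    rfl

/-- Common belief over KD45 does not satisfy negative introspection: in some KD45
model for 2 agents, `¬Cp` holds at a state but `C¬Cp` fails there. -/
theorem no_negative_introspection :
    ∃ M : Model 2, KD45 M ∧ ∃ (s : M.W) (p : ℕ),
      Sat M s (((Formula.atom p).box).neg) ∧
      ¬ Sat M s ((((Formula.atom p).box).neg).box) := by
  refine ⟨forkModel, forkModel_kd45, none, 0, fun h => ?_, fun h => ?_⟩
  · have h₁ : (some 1 : Option (Fin 2)) = some 0 := h _ (forkModel_star_none 1)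
    simp at h₁
  · exact h _ (forkModel_star_none 0) fun _ ht => eq_of_forkModel_star_some ht
end
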